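/- arXiv:2406.15856 — 9 statements merged into one kernel-verified Lean document; each statement's English description precedes it below -/
import Mathlib

section
/- Let Φ = (φ_1,…,φ_m) be a finite family of nonzero vectors in ℝ^n, α ∈ ℝ^m, and ∅ ≠ K ⊆ ℝ^n. If Φ is α-rectifying on K, then for every β ∈ ℝ^m with β_i < α_i for all i ∈ {1,…,m}, the ReLU layer C_β is injective on K. -/
open scoped RealInnerProductSpace

noncomputable section

/-- Euclidean space `ℝ^n`. -/
abbrev Euc (n : ℕ) : Type := EuclideanSpace ℝ (Fin n)

/-- The active index set `I_x^α = {i : ⟨x, φ i⟩ ≥ α i}`. -/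
def activeSet {n m : ℕ} (φ : Fin m → Euc n) (α : Fin m → ℝ) (x : Euc n) : Set (Fin m) :=
  {i | α i ≤ ⟪x, φ i⟫}

/-- `Φ` is `α`-rectifying on `K` if for every `x ∈ K` the active subfamily spans `ℝ^n`. -/
def IsRectifying {n m : ℕ} (φ : Fin m → Euc n) (α : Fin m → ℝ) (K : Set (Euc n)) : Prop :=
  ∀ x ∈ K, Submodule.span ℝ (φ '' activeSet φ α x) = ⊤

/-- The ReLU layer `(C_α x)_i = max (0, ⟨x, φ i⟩ - α i)`. -/
def reluLayer {n m : ℕ} (φ : Fin m → Euc n) (α : Fin m → ℝ) (x : Euc n) :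
    EuclideanSpace ℝ (Fin m) :=
  WithLp.toLp 2 (fun i => max 0 (⟪x, φ i⟫ - α i))

theorem stmt_0 {n m : ℕ} (φ : Fin m → Euc n) (hφ : ∀ i, φ i ≠ 0) (hmn : n ≤ m)
    (α : Fin m → ℝ) (K : Set (Euc n)) (hK : K.Nonempty)
    (hrect : IsRectifying φ α K) :
    ∀ β : Fin m → ℝ, (∀ i, β i < α i) → Set.InjOn (reluLayer φ β) K := by
  intro β hβ x hx y hy hxy
  have key : ∀ i, α i ≤ ⟪x, φ i⟫ → ⟪x - y, φ i⟫ = 0 := by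
    intro i hi
    have h : max 0 (⟪x, φ i⟫ - β i) = max 0 (⟪y, φ i⟫ - β i) :=
      congrArg (fun v : EuclideanSpace ℝ (Fin m) => v i) hxy
    have hb := hβ i
    rw [inner_sub_left]
    rw [max_eq_right (by linarith)] at h
    rcases max_cases 0 (⟪y, φ i⟫ - β i) with ⟨h1, _⟩ | ⟨h1, _⟩ <;> linarith
  have hmem : ∀ v ∈ Submodule.span ℝ (φ '' activeSet φ α x), ⟪x - y, v⟫ = 0 := by
    intro v hv
    induction hv using Submodule.span_induction with
    | mem v hv =>
      obtain ⟨i, hi, rfl⟩ := hv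
      exact key i hi
    | zero => exact inner_zero_right _
    | add a b _ _ ha hb => rw [inner_add_right, ha, hb, add_zero]
    | smul c a _ ha => rw [inner_smul_right, ha, mul_zero]
  have h0 := hmem (x - y) (by rw [hrect x hx]; trivial)
  exact sub_eq_zero.mp (inner_self_eq_zero.mp h0)
end
end

section
/- Let Φ = (φ_1,…,φ_m) be a finite family of nonzero vectors in ℝ^n, α ∈ ℝ^m, and let ∅ ≠ K ⊆ ℝ^n be open or strictly convex (strictly convex meaning: for all x,y ∈ K and λ ∈ (0,1), the point (1−λ)x + λy lies in the interior of K). If the ReLU layer C_α is injective on K, then Φ is α-rectifying on K. -/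
open scoped RealInnerProductSpace

noncomputable section

theorem stmt_2 {n m : ℕ} (φ : Fin m → Euc n) (hφ : ∀ i, φ i ≠ 0) (hmn : n ≤ m)
    (α : Fin m → ℝ) (K : Set (Euc n)) (hK : K.Nonempty)
    (hKoc : IsOpen K ∨
      (∀ x ∈ K, ∀ y ∈ K, ∀ l ∈ Set.Ioo (0:ℝ) 1, (1 - l) • x + l • y ∈ interior K))
    (hinj : Set.InjOn (reluLayer φ α) K) :
    IsRectifying φ α K := by
  have hopen : IsOpen K := by
    rcases hKoc with h | h
    · exact h
    · rw [← subset_interior_iff_isOpen]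
      intro x hx
      have := h x hx x hx (1/2) ⟨by norm_num, by norm_num⟩
      rw [← add_smul] at this
      simpa using this
  intro x hx
  by_contra hne
  obtain ⟨v, hv, hv0⟩ := Submodule.exists_mem_ne_zero_of_ne_bot
    (fun hb => hne (Submodule.orthogonal_eq_bot_iff.1 hb))
  have hc : Continuous (fun t : ℝ => x + t • v) := by fun_prop
  have h1 : ∀ᶠ t in nhds (0:ℝ), x + t • v ∈ K :=
    hc.continuousAt.eventually_mem (hopen.mem_nhds (by simpa using hx))
  have h2 : ∀ᶠ t in nhds (0:ℝ), ∀ i, i ∉ activeSet φ α x → ⟪x + t • v, φ i⟫ < α i := by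
    rw [Filter.eventually_all]
    intro i
    by_cases hi : i ∈ activeSet φ α x
    · simp [hi]
    · have hci : Continuous (fun t : ℝ => ⟪x + t • v, φ i⟫) := by fun_prop
      have hlt : ⟪x + (0:ℝ) • v, φ i⟫ < α i := by
        simpa [activeSet] using hi
      filter_upwards [hci.continuousAt.eventually_lt continuousAt_const hlt] with t ht _
      exact ht
  obtain ⟨t, ⟨ht1, ht2⟩, ht0⟩ := (((h1.and h2).filter_mono nhdsWithin_le_nhds).and
    (self_mem_nhdsWithin : {(0:ℝ)}ᶜ ∈ nhdsWithin (0:ℝ) {(0:ℝ)}ᶜ)).exists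
  have heq : reluLayer φ α (x + t • v) = reluLayer φ α x := by
    unfold reluLayer
    congr 1
    funext i
    by_cases hi : i ∈ activeSet φ α x
    · have hz : ⟪v, φ i⟫ = 0 :=
        (Submodule.mem_orthogonal' _ _).1 hv _ (Submodule.subset_span ⟨i, hi, rfl⟩)
      rw [inner_add_left, real_inner_smul_left, hz]
      simp
    · have ha := ht2 i hi
      have hb : ⟪x, φ i⟫ < α i := by simpa [activeSet] using hi
      rw [max_eq_left (by linarith), max_eq_left (by linarith)]
  have h3 := hinj ht1 hx heq
  have h4 : t • v = 0 := by simpa using h3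
  rcases smul_eq_zero.1 h4 with h | h
  · exact ht0 h
  · exact hv0 h
end
end

section
/- Let Φ = (φ_1,…,φ_m) be a full-spark frame for ℝ^n, i.e., every subfamily of Φ with exactly n elements is linearly independent. Then for any α ∈ ℝ^m and K ⊆ ℝ^n, Φ is α-rectifying on K if and only if the active index set I_x^α has cardinality at least n for every x ∈ K. -/
open scoped RealInnerProductSpace

noncomputable section

theorem stmt_5 {n m : ℕ} (φ : Fin m → Euc n) (hφ : ∀ i, φ i ≠ 0) (hmn : n ≤ m)
    (hspan : Submodule.span ℝ (Set.range φ) = ⊤)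
    (hfullspark : ∀ J : Finset (Fin m), J.card = n →
      LinearIndependent ℝ (fun i : J => φ (i : Fin m)))
    (α : Fin m → ℝ) (K : Set (Euc n)) :
    IsRectifying φ α K ↔ ∀ x ∈ K, n ≤ (activeSet φ α x).ncard := by
  refine forall₂_congr fun x _ => ?_
  set A := activeSet φ α x with hA
  have hfin : A.Finite := Set.toFinite A
  constructor
  · intro h
    have h2 : ((hfin.toFinset.image φ : Finset (Euc n)) : Set (Euc n)) = φ '' A := by
      simp
    have h3 : (hfin.toFinset.image φ).card ≤ A.ncard := by
      rw [Set.ncard_eq_toFinset_card A hfin]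
      exact Finset.card_image_le
    have h4 := finrank_span_finset_le_card (R := ℝ) (hfin.toFinset.image φ)
    rw [Set.finrank, h2, h, finrank_top, finrank_euclideanSpace_fin] at h4
    exact h4.trans h3
  · intro h
    rw [Set.ncard_eq_toFinset_card A hfin] at h
    obtain ⟨J, hJA, hJ⟩ := Finset.exists_subset_card_eq h
    have h1 := (hfullspark J hJ).span_eq_top_of_card_eq_finrank' (by simp [hJ])
    rw [eq_top_iff, ← h1]
    apply Submodule.span_mono
    rintro _ ⟨i, rfl⟩
    exact ⟨i, by simpa using hJA i.2, rfl⟩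
end
end

section
/- Let Φ = (φ_1,…,φ_m) be α-rectifying on K ⊆ ℝ^n. Then: (i) for every r > 0, Φ is (r·α)-rectifying on r·K = {r·x : x ∈ K}; (ii) if α_i ≥ 0 for all i, then Φ is α-rectifying on r·K for every r ≥ 1; (iii) if 0 ∈ K, then at least n of the bias values α_i are non-positive, i.e., |{i : α_i ≤ 0}| ≥ n. -/
open scoped RealInnerProductSpace

noncomputable section

theorem stmt_9 {n m : ℕ} (φ : Fin m → Euc n) (hφ : ∀ i, φ i ≠ 0) (hmn : n ≤ m)
    (α : Fin m → ℝ) (K : Set (Euc n)) (hrect : IsRectifying φ α K) :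
    (∀ r : ℝ, 0 < r → IsRectifying φ (fun i => r * α i) ((fun x => r • x) '' K)) ∧
    ((∀ i, 0 ≤ α i) → ∀ r : ℝ, 1 ≤ r → IsRectifying φ α ((fun x => r • x) '' K)) ∧
    ((0 : Euc n) ∈ K → n ≤ {i : Fin m | α i ≤ 0}.ncard) := by
  have key : ∀ (β : Fin m → ℝ) (x y : Euc n), x ∈ K → activeSet φ α x ⊆ activeSet φ β y →
      Submodule.span ℝ (φ '' activeSet φ β y) = ⊤ := by
    intro β x y hx h
    have h1 := hrect x hx
    rw [eq_top_iff] at h1 ⊢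
    exact h1.trans (Submodule.span_mono (Set.image_mono h))
  refine ⟨?_, ?_, ?_⟩
  · rintro r hr _ ⟨x, hx, rfl⟩
    refine key _ x _ hx ?_
    intro i hi
    simp only [activeSet, Set.mem_setOf_eq, real_inner_smul_left] at hi ⊢
    exact mul_le_mul_of_nonneg_left hi hr.le
  · rintro hα r hr _ ⟨x, hx, rfl⟩
    refine key _ x _ hx ?_
    intro i hi
    simp only [activeSet, Set.mem_setOf_eq, real_inner_smul_left] at hi ⊢
    nlinarith [hα i]
  · intro h0
    have h := hrect 0 h0
    have he : activeSet φ α 0 = {i : Fin m | α i ≤ 0} := by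
      ext i
      simp [activeSet]
    rw [he] at h
    classical
    have h2 := finrank_span_le_card (R := ℝ) (φ '' {i : Fin m | α i ≤ 0})
    rw [h, finrank_top, finrank_euclideanSpace_fin, ← Set.ncard_eq_toFinset_card'] at h2
    exact h2.trans (Set.ncard_image_le (Set.toFinite _))
end
end

section
/- Let Φ = (φ_1,…,φ_m) be a frame for ℝ^n and α ∈ ℝ^m. Define the maximal domain K*_α = ⋃_J ⋂_{i∈J} Ω_i^α, where the union runs over all subsets J ⊆ {1,…,m} such that (φ_i)_{i∈J} is a basis of ℝ^n, and Ω_i^α = {x ∈ ℝ^n : ⟨x,φ_i⟩ ≥ α_i}. Then for every K ⊆ ℝ^n, Φ is α-rectifying on K if and only if K ⊆ K*_α. -/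
open scoped RealInnerProductSpace

noncomputable section

/-- `(φ i)_{i ∈ J}` is a basis of `ℝ^n`: linearly independent and spanning. -/
def IsBasisIndex {n m : ℕ} (φ : Fin m → Euc n) (J : Set (Fin m)) : Prop :=
  LinearIndependent ℝ (fun i : J => φ (i : Fin m)) ∧ Submodule.span ℝ (φ '' J) = ⊤


theorem stmt_10 {n m : ℕ} (φ : Fin m → Euc n) (hφ : ∀ i, φ i ≠ 0) (hmn : n ≤ m)
    (hspan : Submodule.span ℝ (Set.range φ) = ⊤) (α : Fin m → ℝ) (K : Set (Euc n)) :
    IsRectifying φ α K ↔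
      K ⊆ ⋃ J ∈ {J : Set (Fin m) | IsBasisIndex φ J},
            ⋂ i ∈ J, {x : Euc n | α i ≤ ⟪x, φ i⟫} := by
  constructor
  · intro h x hx
    obtain ⟨J, hJ, -, hs, hli⟩ := exists_linearIndepOn_extension
      (K := ℝ) (v := φ) (linearIndepOn_empty ℝ φ) (Set.empty_subset (activeSet φ α x))
    simp only [Set.mem_iUnion, Set.mem_iInter]
    refine ⟨J, ⟨hli, ?_⟩, fun i hi => hJ hi⟩
    rw [eq_top_iff, ← h x hx]
    exact Submodule.span_le.2 hs
  · intro h x hx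
    have hx' := h hx
    simp only [Set.mem_iUnion, Set.mem_iInter] at hx'
    obtain ⟨J, hJ, hJx⟩ := hx'
    rw [eq_top_iff, ← hJ.2]
    exact Submodule.span_mono (Set.image_mono fun i hi => hJx i hi)
end
end

section
/- Let Φ = (φ_1,…,φ_m) be a frame for ℝ^n, let ∅ ≠ K ⊆ ℝ^n, and let r ∈ ℝ. Then Φ is 𝐫-rectifying on K for the constant bias 𝐫 = (r,…,r) if and only if for every x ∈ K we have r ≤ max{ min_{j∈J} ⟨x,φ_j⟩ : J ⊆ {1,…,m}, (φ_j)_{j∈J} a basis of ℝ^n } (equivalently, r does not exceed the maximal constant bias α_c = inf_{x∈K} max_{J basis} min_{j∈J} ⟨x,φ_j⟩). -/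
open scoped RealInnerProductSpace

noncomputable section

theorem stmt_12 {n m : ℕ} (φ : Fin m → Euc n) (hφ : ∀ i, φ i ≠ 0) (hmn : n ≤ m)
    (hspan : Submodule.span ℝ (Set.range φ) = ⊤)
    (K : Set (Euc n)) (hK : K.Nonempty) (r : ℝ) :
    IsRectifying φ (fun _ => r) K ↔
      ∀ x ∈ K, ∃ J : Set (Fin m), IsBasisIndex φ J ∧ ∀ j ∈ J, r ≤ ⟪x, φ j⟫ := by
  constructor
  · intro h x hx
    obtain ⟨b, hbt, -, hsp, hli⟩ := exists_linearIndepOn_extension (K := ℝ) (v := φ)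
      (linearIndepOn_empty ℝ φ) (Set.empty_subset (activeSet φ (fun _ => r) x))
    refine ⟨b, ⟨hli, ?_⟩, fun j hj => hbt hj⟩
    rw [eq_top_iff, ← h x hx]
    exact Submodule.span_le.2 hsp
  · intro h x hx
    obtain ⟨J, ⟨-, hJ⟩, hr⟩ := h x hx
    rw [eq_top_iff, ← hJ]
    exact Submodule.span_mono (Set.image_mono fun j hj => hr j hj)
end
end

section
/- Let Φ = (φ_1,…,φ_m) be a family of unit vectors in ℝ^n, K ⊆ ℝ^n, and let X = {x_1,…,x_N} ⊆ K be a finite nonempty set with covering radius ρ = sup_{x∈K} min_{1≤k≤N} ‖x − x_k‖. If Φ is α-rectifying on X for some α ∈ ℝ^m, then Φ is (α − ρ·𝟙)-rectifying on K, where (α − ρ·𝟙)_i = α_i − ρ for each i. -/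
open scoped RealInnerProductSpace

noncomputable section

theorem stmt_15 {n m : ℕ} (φ : Fin m → Euc n) (hφ : ∀ i, ‖φ i‖ = 1) (hmn : n ≤ m)
    (K : Set (Euc n)) (X : Finset (Euc n)) (hXne : X.Nonempty) (hXK : ↑X ⊆ K)
    (ρ : ℝ)
    (hbdd : BddAbove ((fun x => sInf ((fun k => ‖x - k‖) '' (X : Set (Euc n)))) '' K))
    (hρ : ρ = sSup ((fun x => sInf ((fun k => ‖x - k‖) '' (X : Set (Euc n)))) '' K))
    (α : Fin m → ℝ) (hrect : IsRectifying φ α ↑X) :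
    IsRectifying φ (fun i => α i - ρ) K := by
  intro x hx
  have hfin : ((fun k => ‖x - k‖) '' (X : Set (Euc n))).Finite := X.finite_toSet.image _
  have hne : ((fun k => ‖x - k‖) '' (X : Set (Euc n))).Nonempty := hXne.to_set.image _
  obtain ⟨k, hk, hkx⟩ := hne.csInf_mem hfin
  have hle : ‖x - k‖ ≤ ρ := by
    rw [hρ]
    refine le_trans (le_of_eq hkx) (le_csSup hbdd ⟨x, hx, rfl⟩)
  rw [eq_top_iff, ← hrect k hk]
  apply Submodule.span_mono
  apply Set.image_mono
  intro i hi
  have hi' : α i ≤ ⟪k, φ i⟫ := hi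
  change α i - ρ ≤ ⟪x, φ i⟫
  have h1 := abs_real_inner_le_norm (x - k) (φ i)
  rw [hφ i, mul_one, inner_sub_left] at h1
  have h2 := (abs_le.mp h1).1
  linarith
end
end

section
/- Let Φ = (φ_1,…,φ_m) be a family of unit vectors in ℝ^n that is omnidirectional, i.e., 0 lies in the interior of the convex hull P_Φ of {φ_1,…,φ_m}, and let K ⊆ ℝ^n be bounded. Suppose α ∈ ℝ^m satisfies: for every i ∈ {1,…,m}, every facet F of P_Φ with φ_i ∈ F, and every x ∈ cone(F) ∩ K (where cone(F) = {c·y : y ∈ F, c ≥ 0}), we have α_i ≤ ⟨x,φ_i⟩. Then Φ is α-rectifying on K. -/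
open scoped RealInnerProductSpace

noncomputable section

/-- `F` is a facet of the inscribing polytope `P_Φ = conv{φ_1,…,φ_m}`. -/
def IsFacet {n m : ℕ} (φ : Fin m → Euc n) (F : Set (Euc n)) : Prop :=
  ∃ a : Euc n, ∃ b : ℝ, a ≠ 0 ∧
    (∀ y ∈ convexHull ℝ (Set.range φ), ⟪a, y⟫ ≤ b) ∧
    F = {x ∈ convexHull ℝ (Set.range φ) | ⟪a, x⟫ = b} ∧
    Module.finrank ℝ (affineSpan ℝ F).direction = n - 1

lemma exists_facet_functional {n m : ℕ} (φ : Fin m → Euc n)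
    (homni : (0 : Euc n) ∈ interior (convexHull ℝ (Set.range φ))) (x : Euc n) :
    ∃ a : Euc n, (∀ i, ⟪a, φ i⟫ ≤ 1) ∧
      (∀ b : Euc n, (∀ i, ⟪b, φ i⟫ ≤ 1) → ⟪b, x⟫ ≤ ⟪a, x⟫) ∧
      Submodule.span ℝ (φ '' {i | ⟪a, φ i⟫ = 1}) = ⊤ := by
  set Q : Set (Euc n) := {a | ∀ i, ⟪a, φ i⟫ ≤ 1} with hQ
  have hhull : ∀ a ∈ Q, ∀ y ∈ convexHull ℝ (Set.range φ), ⟪a, y⟫ ≤ 1 := by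
    intro a ha y hy
    have hc : Convex ℝ {y : Euc n | ⟪a, y⟫ ≤ 1} :=
      convex_halfSpace_le (f := fun y : Euc n => ⟪a, y⟫)
        ⟨fun u v => inner_add_right _ _ _, fun c u => by simp [inner_smul_right]⟩ 1
    have : convexHull ℝ (Set.range φ) ⊆ {y : Euc n | ⟪a, y⟫ ≤ 1} :=
      convexHull_min (by rintro _ ⟨i, rfl⟩; exact ha i) hc
    exact this hy
  have hclosed : IsClosed Q := by
    have : Q = ⋂ i, {a | ⟪a, φ i⟫ ≤ 1} := by ext; simp [hQ]
    rw [this]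
    exact isClosed_iInter fun i => isClosed_le (by fun_prop) continuous_const
  have hbdd : Bornology.IsBounded Q := by
    obtain ⟨r, hr, hball⟩ := Metric.mem_nhds_iff.1 (mem_interior_iff_mem_nhds.1 homni)
    refine (Metric.isBounded_iff_subset_closedBall 0).2 ⟨2 / r, fun a ha => ?_⟩
    rw [mem_closedBall_zero_iff]
    by_cases h0 : a = 0
    · subst h0; simp; positivity
    have hn : 0 < ‖a‖ := norm_pos_iff.2 h0
    have hy : ((r / 2) / ‖a‖) • a ∈ convexHull ℝ (Set.range φ) := by
      apply hball
      rw [mem_ball_zero_iff, norm_smul, Real.norm_of_nonneg (by positivity),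
        div_mul_cancel₀ _ hn.ne']
      linarith
    have := hhull a ha _ hy
    rw [inner_smul_right, real_inner_self_eq_norm_sq] at this
    have h2 : r / 2 / ‖a‖ * ‖a‖ ^ 2 = r / 2 * ‖a‖ := by field_simp
    rw [h2] at this
    rw [le_div_iff₀ hr]
    linarith
  have hcomp : IsCompact Q := Metric.isCompact_of_isClosed_isBounded hclosed hbdd
  obtain ⟨a₀, ha₀, hmax⟩ := hcomp.exists_isMaxOn ⟨0, by simp [hQ]⟩
    (f := fun a : Euc n => ⟪a, x⟫) (by fun_prop)
  have hcompF : IsCompact (Q ∩ {a | ⟪a, x⟫ = ⟪a₀, x⟫}) :=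
    hcomp.inter_right (isClosed_eq (by fun_prop) continuous_const)
  obtain ⟨a, ha⟩ := hcompF.extremePoints_nonempty ⟨a₀, ha₀, rfl⟩
  obtain ⟨⟨haQ, hax⟩, hext⟩ := ha
  simp only [Set.mem_ofPred_eq] at hax
  refine ⟨a, haQ, fun b hb => hax ▸ hmax hb, ?_⟩
  by_contra hne
  set S := Submodule.span ℝ (φ '' {i | ⟪a, φ i⟫ = 1}) with hS
  have : Sᗮ ≠ ⊥ := fun h => hne (Submodule.orthogonal_eq_bot_iff.1 h)
  obtain ⟨v, hvS, hv0⟩ := Submodule.exists_mem_ne_zero_of_ne_bot this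
  have hvi : ∀ i, ⟪a, φ i⟫ = 1 → ⟪v, φ i⟫ = 0 := fun i hi =>
    Submodule.inner_left_of_mem_orthogonal (K := S)
      (Submodule.subset_span (Set.mem_image_of_mem φ hi)) hvS
  -- small perturbations stay feasible
  have hsmall : ∀ᶠ t : ℝ in nhds 0, ∀ i, ⟪a + t • v, φ i⟫ ≤ 1 := by
    rw [Filter.eventually_all]
    intro i
    by_cases hi : ⟪a, φ i⟫ = 1
    · refine Filter.Eventually.of_forall fun t => ?_
      rw [inner_add_left, inner_smul_left, hvi i hi, hi]; simp
    · have hlt : ⟪a, φ i⟫ < 1 := lt_of_le_of_ne (haQ i) hi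
      have hcont : Continuous fun t : ℝ => ⟪a + t • v, φ i⟫ := by fun_prop
      have := (hcont.tendsto 0).eventually_lt_const (u := 1) (by simpa using hlt)
      exact this.mono fun t ht => ht.le
  obtain ⟨ε, hε, hb⟩ := Metric.eventually_nhds_iff.1 hsmall
  have h1 : a + (ε / 2) • v ∈ Q := hb (by
    rw [dist_zero_right, Real.norm_of_nonneg (by positivity)]; linarith)
  have h2 : a + (-(ε / 2)) • v ∈ Q := hb (by
    rw [dist_zero_right, norm_neg, Real.norm_of_nonneg (by positivity)]; linarith)
  have m1 : ⟪a + (ε / 2) • v, x⟫ ≤ ⟪a₀, x⟫ := hmax h1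
  have m2 : ⟪a + (-(ε / 2)) • v, x⟫ ≤ ⟪a₀, x⟫ := hmax h2
  have e1 : ⟪a + (ε / 2) • v, x⟫ = ⟪a₀, x⟫ + ε / 2 * ⟪v, x⟫ := by
    rw [inner_add_left, inner_smul_left, hax]; simp
  have e2 : ⟪a + (-(ε / 2)) • v, x⟫ = ⟪a₀, x⟫ - ε / 2 * ⟪v, x⟫ := by
    rw [inner_add_left, inner_smul_left, hax]; simp; ring
  have hz : ε / 2 * ⟪v, x⟫ = 0 := by linarith
  have hseg : a ∈ openSegment ℝ (a + (ε / 2) • v) (a + (-(ε / 2)) • v) :=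
    ⟨1 / 2, 1 / 2, by norm_num, by norm_num, by norm_num, by module⟩
  have := hext ⟨h1, by simp only [Set.mem_ofPred_eq]; linarith⟩
    ⟨h2, by simp only [Set.mem_ofPred_eq]; linarith⟩ hseg
  have h3 : (ε / 2) • v = 0 := by simpa using this
  rcases smul_eq_zero.1 h3 with h | h
  · linarith
  · exact hv0 h

theorem stmt_17 {n m : ℕ} (φ : Fin m → Euc n) (hφ : ∀ i, ‖φ i‖ = 1) (hmn : n ≤ m)
    (homni : (0 : Euc n) ∈ interior (convexHull ℝ (Set.range φ)))
    (K : Set (Euc n)) (hK : Bornology.IsBounded K) (α : Fin m → ℝ)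
    (hα : ∀ i : Fin m, ∀ F : Set (Euc n), IsFacet φ F → φ i ∈ F →
      ∀ x ∈ {z : Euc n | ∃ c : ℝ, 0 ≤ c ∧ ∃ y ∈ F, z = c • y} ∩ K, α i ≤ ⟪x, φ i⟫) :
    IsRectifying φ α K := by
  intro x hx
  rcases Nat.eq_zero_or_pos n with rfl | hn
  · exact Subsingleton.elim _ _
  obtain ⟨a, haQ, hmax, hspan⟩ := exists_facet_functional φ homni x
  set P := convexHull ℝ (Set.range φ) with hP
  set F : Set (Euc n) := {y ∈ P | ⟪a, y⟫ = 1} with hF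
  have hiF : ∀ i, ⟪a, φ i⟫ = 1 → φ i ∈ F := fun i hi =>
    ⟨subset_convexHull ℝ _ ⟨i, rfl⟩, hi⟩
  have : Nonempty (Fin n) := ⟨⟨0, hn⟩⟩
  have hA : ∃ i, ⟪a, φ i⟫ = 1 := by
    by_contra h
    push Not at h
    have : {i | ⟪a, φ i⟫ = 1} = ∅ := by ext i; simp [h i]
    rw [this, Set.image_empty, Submodule.span_empty] at hspan
    exact bot_ne_top hspan
  obtain ⟨i₀, hi₀⟩ := hA
  have ha0 : a ≠ 0 := by rintro rfl; simp at hi₀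
  have hle : ∀ y ∈ P, ⟪a, y⟫ ≤ 1 := by
    intro y hy
    have hc : Convex ℝ {y : Euc n | ⟪a, y⟫ ≤ 1} :=
      convex_halfSpace_le (f := fun y : Euc n => ⟪a, y⟫)
        ⟨fun u v => inner_add_right _ _ _, fun c u => by simp [inner_smul_right]⟩ 1
    have : P ⊆ {y : Euc n | ⟪a, y⟫ ≤ 1} :=
      convexHull_min (by rintro _ ⟨i, rfl⟩; exact haQ i) hc
    exact this hy
  have hfacet : IsFacet φ F := by
    refine ⟨a, 1, ha0, hle, rfl, ?_⟩
    rw [direction_affineSpan]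
    have hup : Module.finrank ℝ (vectorSpan ℝ F) < n := by
      have hVle : vectorSpan ℝ F ≤ (Submodule.span ℝ {a})ᗮ := by
        rw [vectorSpan_def, Submodule.span_le]
        rintro _ ⟨y, hy, z, hz, rfl⟩
        rw [SetLike.mem_coe, Submodule.mem_orthogonal_singleton_iff_inner_right]
        change ⟪a, y - z⟫ = 0
        rw [inner_sub_right, hy.2, hz.2, sub_self]
      have hne : vectorSpan ℝ F ≠ ⊤ := by
        intro h
        have : a ∈ (Submodule.span ℝ {a})ᗮ := hVle (h ▸ Submodule.mem_top)
        rw [Submodule.mem_orthogonal_singleton_iff_inner_right] at this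
        exact ha0 (inner_self_eq_zero.1 this)
      simpa using Submodule.finrank_lt (lt_top_iff_ne_top.2 hne).ne
    have hlow : n ≤ Module.finrank ℝ (vectorSpan ℝ F) + 1 := by
      have htop : vectorSpan ℝ F ⊔ Submodule.span ℝ {φ i₀} = ⊤ := by
        rw [eq_top_iff, ← hspan, Submodule.span_le]
        rintro _ ⟨i, hi, rfl⟩
        have h1 : φ i - φ i₀ ∈ vectorSpan ℝ F :=
          vsub_mem_vectorSpan ℝ (hiF i hi) (hiF i₀ hi₀)
        have := Submodule.add_mem_sup h1 (Submodule.mem_span_singleton_self (R := ℝ) (φ i₀))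
        simpa using this
      have h2 := Submodule.finrank_add_le_finrank_add_finrank (vectorSpan ℝ F)
        (Submodule.span ℝ {φ i₀})
      rw [htop, finrank_top, finrank_euclideanSpace_fin] at h2
      have h3 : Module.finrank ℝ (Submodule.span ℝ {φ i₀}) ≤ 1 := by
        simpa using finrank_span_le_card (R := ℝ) ({φ i₀} : Set (Euc n))
      omega
    omega
  have hcone : ∃ c : ℝ, 0 ≤ c ∧ ∃ y ∈ F, x = c • y := by
    by_cases hx0 : x = 0
    · exact ⟨0, le_rfl, φ i₀, hiF i₀ hi₀, by simp [hx0]⟩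
    have hxp : 0 < ‖x‖ := norm_pos_iff.2 hx0
    have hM : 0 < ⟪a, x⟫ := by
      have h1 : ∀ i, ⟪(1 / ‖x‖) • x, φ i⟫ ≤ 1 := by
        intro i
        refine (real_inner_le_norm _ _).trans ?_
        rw [hφ i, norm_smul, Real.norm_of_nonneg (by positivity)]
        field_simp
        exact le_rfl
      refine lt_of_lt_of_le ?_ (hmax _ h1)
      rw [inner_smul_left, real_inner_self_eq_norm_sq]
      simp only [conj_trivial]
      positivity
    refine ⟨⟪a, x⟫, hM.le, (⟪a, x⟫)⁻¹ • x, ⟨?_, ?_⟩, ?_⟩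
    · by_contra hnot
      have hPc : IsClosed P := (Set.finite_range φ).isClosed_convexHull ℝ
      obtain ⟨f, u, hfu, huf⟩ := geometric_hahn_banach_closed_point
        (convex_convexHull ℝ _) hPc hnot
      have hu : 0 < u := by simpa using hfu 0 (interior_subset homni)
      set w := (InnerProductSpace.toDual ℝ (Euc n)).symm f with hw
      have hwf : ∀ y, ⟪w, y⟫ = f y := fun y => by
        rw [hw, InnerProductSpace.toDual_symm_apply]
      have hfe : ∀ i, ⟪u⁻¹ • w, φ i⟫ ≤ 1 := by
        intro i
        rw [inner_smul_left, hwf]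
        simp only [conj_trivial]
        rw [inv_mul_le_iff₀ hu, mul_one]
        exact (hfu _ (subset_convexHull ℝ _ ⟨i, rfl⟩)).le
      have h4 := hmax _ hfe
      rw [inner_smul_left, hwf] at h4
      simp only [conj_trivial] at h4
      rw [map_smul, smul_eq_mul, lt_inv_mul_iff₀ hM] at huf
      rw [inv_mul_le_iff₀ hu] at h4
      linarith
    · rw [inner_smul_right, inv_mul_cancel₀ hM.ne']
    · rw [smul_smul, mul_inv_cancel₀ hM.ne', one_smul]
  rw [eq_top_iff, ← hspan]
  apply Submodule.span_mono
  apply Set.image_mono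
  intro i hi
  exact hα i F hfacet (hiF i hi) x ⟨hcone, hx⟩
end
end

section
/- Let Φ = (φ_1,…,φ_m) be α-rectifying on K ⊆ ℝ^n, let x_0 ∈ K, and let J ⊆ I_{x_0}^α be such that (φ_i)_{i∈J} spans ℝ^n with lower frame bound A_J > 0, i.e., A_J·‖z‖² ≤ Σ_{i∈J} ⟨z,φ_i⟩² for all z ∈ ℝ^n. Then for every β ∈ ℝ^m with β_i < α_i for all i, there exists ε > 0 such that for all y, z ∈ ℝ^n with ‖y − x_0‖ < ε and ‖z − x_0‖ < ε, one has ‖y − z‖² ≤ A_J^{-1}·‖C_β y − C_β z‖²; that is, Φ allows A_J^{-1}-stable β-rectification near x_0. -/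
open scoped RealInnerProductSpace

noncomputable section

theorem stmt_19 {n m : ℕ} (φ : Fin m → Euc n) (hφ : ∀ i, φ i ≠ 0) (hmn : n ≤ m)
    (α : Fin m → ℝ) (K : Set (Euc n)) (hrect : IsRectifying φ α K)
    (x₀ : Euc n) (hx₀ : x₀ ∈ K)
    (J : Set (Fin m)) (hJsub : J ⊆ activeSet φ α x₀)
    (hJspan : Submodule.span ℝ (φ '' J) = ⊤)
    (A : ℝ) (hA : 0 < A)
    (hlow : ∀ z : Euc n, A * ‖z‖ ^ 2 ≤ ∑ i, J.indicator (fun j => ⟪z, φ j⟫ ^ 2) i) :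
    ∀ β : Fin m → ℝ, (∀ i, β i < α i) →
      ∃ ε > 0, ∀ y z : Euc n, ‖y - x₀‖ < ε → ‖z - x₀‖ < ε →
        ‖y - z‖ ^ 2 ≤ A⁻¹ * ‖reluLayer φ β y - reluLayer φ β z‖ ^ 2 := by
  intro β hβ
  have hev : ∀ᶠ y in nhds x₀, ∀ i ∈ J, β i < ⟪y, φ i⟫ := by
    rw [Filter.eventually_all_finite J.toFinite]
    intro i hi
    have hc : Continuous (fun y : Euc n => ⟪y, φ i⟫) := by fun_prop
    exact hc.continuousAt.eventually (lt_mem_nhds (lt_of_lt_of_le (hβ i) (hJsub hi)))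
  obtain ⟨ε, hε, hball⟩ := Metric.eventually_nhds_iff.1 hev
  refine ⟨ε, hε, fun y z hy hz => ?_⟩
  have hy' := hball (y := y) (by rwa [dist_eq_norm])
  have hz' := hball (y := z) (by rwa [dist_eq_norm])
  rw [inv_mul_eq_div, le_div_iff₀ hA, mul_comm]
  refine (hlow (y - z)).trans ?_
  rw [EuclideanSpace.norm_sq_eq]
  refine Finset.sum_le_sum fun i _ => ?_
  by_cases hi : i ∈ J
  · have h1 := hy' i hi
    have h2 := hz' i hi
    have e : (reluLayer φ β y - reluLayer φ β z) i = ⟪y - z, φ i⟫ := by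
      simp only [reluLayer, PiLp.sub_apply]
      rw [max_eq_right (by linarith), max_eq_right (by linarith), inner_sub_left]
      ring
    rw [Set.indicator_of_mem hi, e, Real.norm_eq_abs, sq_abs]
  · rw [Set.indicator_of_notMem hi]
    positivity
end
end
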